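/- arXiv:1110.2928 — 3 statements merged into one kernel-verified Lean document; each statement's English description precedes it below -/
import Mathlib

section
/- Let q be a positive integer. If R = A/I is a monomial ring such that I ⊆ 𝔪_A², and R_q = A/I_q, then for every i ≥ 0 the k-vector spaces Tor_i^R(k,k) and Tor_i^{R_q}(k,k) have the same (finite) dimension; equivalently, the Poincaré series of R and R_q coincide: P_k^R(z) = P_k^{R_q}(z). -/
open CategoryTheory MvPolynomial

/-- `Tor_i^R(R/J, R/J)` as an object of `ModuleCat R`; for `J` the maximal ideal of a
local `k`-algebra `R` this is `Tor_i^R(k, k)`. -/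
noncomputable def TorResidue (R : Type) [CommRing R] (J : Ideal R) (i : ℕ) : ModuleCat R :=
  ((Tor (ModuleCat R) i).obj (ModuleCat.of R (R ⧸ J))).obj (ModuleCat.of R (R ⧸ J))

/-- `Tor_i^R(R/J, R/J)` regarded as a `k`-vector space via `algebraMap k R`. -/
noncomputable def TorVS (k : Type) [Field k] (R : Type) [CommRing R] [Algebra k R]
    (J : Ideal R) (i : ℕ) : Type :=
  TorResidue R J i

noncomputable instance (k : Type) [Field k] (R : Type) [CommRing R] [Algebra k R]
    (J : Ideal R) (i : ℕ) : AddCommGroup (TorVS k R J i) :=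
  inferInstanceAs (AddCommGroup (TorResidue R J i))

noncomputable instance (k : Type) [Field k] (R : Type) [CommRing R] [Algebra k R]
    (J : Ideal R) (i : ℕ) : Module k (TorVS k R J i) :=
  Module.compHom (TorResidue R J i) (algebraMap k R)

/-- The maximal ideal of `A/I`: the image of `𝔪_A = (x_1, …, x_n)`. -/
noncomputable def resMax (k : Type) [Field k] (n : ℕ) (I : Ideal (MvPolynomial (Fin n) k)) :
    Ideal (MvPolynomial (Fin n) k ⧸ I) :=
  Ideal.map (Ideal.Quotient.mk I) (Ideal.span (Set.range (X : Fin n → MvPolynomial (Fin n) k)))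

section FreeResolutions

/-- The module `Tor_i^R(R/J, M)`. -/
noncomputable def torQuotient (R : Type) [CommRing R] (J : Ideal R) (M : ModuleCat.{0} R) (i : ℕ) :
    ModuleCat R :=
  ((Tor (ModuleCat R) i).obj (ModuleCat.of R (R ⧸ J))).obj M

/-- `Tor_i^R(R/J, M)` regarded as a `k`-vector space via `algebraMap k R`. -/
noncomputable def TorQuotient (k : Type) [Field k] (R : Type) [CommRing R] [Algebra k R]
    (J : Ideal R) (M : ModuleCat.{0} R) (i : ℕ) : Type :=
  torQuotient R J M i

noncomputable instance (k : Type) [Field k] (R : Type) [CommRing R] [Algebra k R]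
    (J : Ideal R) (M : ModuleCat.{0} R) (i : ℕ) : AddCommGroup (TorQuotient k R J M i) :=
  inferInstanceAs (AddCommGroup (torQuotient R J M i))

noncomputable instance (k : Type) [Field k] (R : Type) [CommRing R] [Algebra k R]
    (J : Ideal R) (M : ModuleCat.{0} R) (i : ℕ) : Module R (TorQuotient k R J M i) :=
  inferInstanceAs (Module R (torQuotient R J M i))

noncomputable instance (k : Type) [Field k] (R : Type) [CommRing R] [Algebra k R]
    (J : Ideal R) (M : ModuleCat.{0} R) (i : ℕ) : Module k (TorQuotient k R J M i) :=
  Module.compHom (torQuotient R J M i) (algebraMap k R)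

instance (k : Type) [Field k] (R : Type) [CommRing R] [Algebra k R]
    (J : Ideal R) (M : ModuleCat.{0} R) (i : ℕ) : IsScalarTower k R (TorQuotient k R J M i) :=
  IsScalarTower.of_compHom k R (torQuotient R J M i)

/-- A resolution of a module by finite free modules. -/
structure FreeResolution (R : Type) [CommRing R] (M : Type) [AddCommGroup M] [Module R M] where
  /-- the ranks of the free modules -/
  b : ℕ → ℕ
  /-- the differentials -/
  d : ∀ i, (Fin (b (i + 1)) → R) →ₗ[R] (Fin (b i) → R)
  /-- the augmentation -/
  ε : (Fin (b 0) → R) →ₗ[R] M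
  surjective : Function.Surjective ε
  exact_zero : Function.Exact (d 0) ε
  exact_succ : ∀ i, Function.Exact (d (i + 1)) (d i)

namespace FreeResolution

variable {R : Type} [CommRing R] {M : Type} [AddCommGroup M] [Module R M]

/-- The rank of the `i`-th differential after base change along `aug : R → k`. -/
noncomputable def rk {k : Type} [Field k] (L : FreeResolution R M) (aug : R →+* k) (i : ℕ) : ℕ :=
  ((LinearMap.toMatrix' (L.d i)).map aug).rank

/-- The chain complex underlying a free resolution. -/
noncomputable def cpx (L : FreeResolution R M) : ChainComplex (ModuleCat R) ℕ :=
  ChainComplex.of (fun i => ModuleCat.of R (Fin (L.b i) → R)) (fun i => ModuleCat.ofHom (L.d i))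
    (fun i => by
      rw [← ModuleCat.ofHom_comp, (L.exact_succ i).linearMap_comp_eq_zero]
      rfl)

lemma cpx_d (L : FreeResolution R M) (i : ℕ) : L.cpx.d (i + 1) i = ModuleCat.ofHom (L.d i) :=
  ChainComplex.of_d (fun i => ModuleCat.of R (Fin (L.b i) → R)) (fun i => ModuleCat.ofHom (L.d i)) i

/-- A free resolution as a projective resolution in `ModuleCat R`. -/
noncomputable def toProjectiveResolution (L : FreeResolution R M) :
    ProjectiveResolution (ModuleCat.of R M) where
  complex := L.cpx
  projective n := by
    change Projective (ModuleCat.of R (Fin (L.b n) → R))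
    infer_instance
  π := (ChainComplex.toSingle₀Equiv _ _).symm ⟨ModuleCat.ofHom L.ε, by
    rw [cpx_d]
    have h : ModuleCat.ofHom (L.ε ∘ₗ L.d 0) = 0 := by
      rw [L.exact_zero.linearMap_comp_eq_zero]; rfl
    exact h⟩
  quasiIso := ⟨fun n => by
    cases n
    · rw [ChainComplex.quasiIsoAt₀_iff, ShortComplex.quasiIso_iff_of_zeros']
      · constructor
        · rw [ShortComplex.ShortExact.moduleCat_exact_iff_function_exact]
          have := L.exact_zero
          have h2 : (ConcreteCategory.hom (L.cpx.d 1 0) : _ → _) = L.d 0 := by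
            rw [cpx_d]; rfl
          change Function.Exact (ConcreteCategory.hom (L.cpx.d 1 0)) L.ε
          rw [h2]
          exact this
        · exact (ModuleCat.epi_iff_surjective _).2 L.surjective
      all_goals rfl
    · rw [quasiIsoAt_iff_exactAt']
      · rename_i n
        rw [HomologicalComplex.exactAt_iff' _ (n + 1 + 1) (n + 1) n (by simp) (by simp),
          ShortComplex.ShortExact.moduleCat_exact_iff_function_exact]
        have h1 : (ConcreteCategory.hom (L.cpx.d (n + 1) n) : _ → _) = L.d n := by
          rw [cpx_d]; rfl
        have h2 : (ConcreteCategory.hom (L.cpx.d (n + 1 + 1) (n + 1)) : _ → _) = L.d (n + 1) := by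
          rw [cpx_d]; rfl
        change Function.Exact (ConcreteCategory.hom (L.cpx.d (n + 1 + 1) (n + 1)))
          (ConcreteCategory.hom (L.cpx.d (n + 1) n))
        rw [h1, h2]
        exact L.exact_succ n
      · apply ChainComplex.exactAt_succ_single_obj⟩

end FreeResolution

end FreeResolutions

section Dimension

variable {k : Type} [Field k] {R : Type} [CommRing R] [Algebra k R]

/-- Dimension count for the homology of a short complex of `k`-finite modules. -/
lemma finrank_homology {X Y Z H : Type}
    [AddCommGroup X] [Module R X] [AddCommGroup Y] [Module R Y] [AddCommGroup Z] [Module R Z]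
    [AddCommGroup H] [Module R H] [Module k X] [IsScalarTower k R X] [Module k Y]
    [IsScalarTower k R Y] [Module k Z] [IsScalarTower k R Z] [Module k H] [IsScalarTower k R H]
    [Module.Finite k Y] (f : X →ₗ[R] Y) (g : Y →ₗ[R] Z) (h : ∀ x, f x ∈ LinearMap.ker g)
    (e : (LinearMap.ker g ⧸ LinearMap.range (f.codRestrict _ h)) ≃ₗ[R] H) :
    Module.Finite k H ∧ Module.finrank k H + Module.finrank k (LinearMap.range f) +
      Module.finrank k (LinearMap.range g) = Module.finrank k Y := by
  have : Module.Finite k (LinearMap.ker (g.restrictScalars k)) := inferInstance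
  let p : LinearMap.ker g →ₗ[R] H := e.toLinearMap ∘ₗ (Submodule.mkQ _)
  have hp : Function.Surjective p := e.surjective.comp (Submodule.mkQ_surjective _)
  have hker : LinearMap.ker p = LinearMap.range (f.codRestrict _ h) := by
    simp [p, LinearMap.ker_comp]
  let p' : LinearMap.ker (g.restrictScalars k) →ₗ[k] H := p.restrictScalars k
  have hp' : Function.Surjective p' := hp
  refine ⟨Module.Finite.of_surjective p' hp', ?_⟩
  have h1 := LinearMap.finrank_range_add_finrank_ker p'
  have h2 := LinearMap.finrank_range_add_finrank_ker (g.restrictScalars k)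
  have h3 : Module.finrank k (LinearMap.range p') = Module.finrank k H := by
    rw [LinearMap.range_eq_top.2 hp', finrank_top]
  have h4 : Module.finrank k (LinearMap.ker p') = Module.finrank k (LinearMap.range f) := by
    have h5 : (LinearMap.ker p').map (LinearMap.ker (g.restrictScalars k)).subtype =
        LinearMap.range (f.restrictScalars k) := by
      ext y
      simp only [Submodule.mem_map, LinearMap.mem_ker, LinearMap.mem_range]
      constructor
      · rintro ⟨z, hz, rfl⟩
        have : (z : LinearMap.ker g) ∈ LinearMap.range (f.codRestrict _ h) := hker ▸ hz
        obtain ⟨x, hx⟩ := this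
        exact ⟨x, congrArg Subtype.val hx⟩
      · rintro ⟨x, rfl⟩
        refine ⟨⟨f x, h x⟩, ?_, rfl⟩
        have : (⟨f x, h x⟩ : LinearMap.ker g) ∈ LinearMap.ker p := hker ▸ ⟨x, rfl⟩
        exact this
    have h6 := LinearEquiv.finrank_eq (Submodule.equivSubtypeMap _ (LinearMap.ker p'))
    rw [h5] at h6
    exact h6
  have h7 : Module.finrank k (LinearMap.range (g.restrictScalars k)) =
    Module.finrank k (LinearMap.range g) := rfl
  omega

/-- A `k`-algebra map `aug : R → k` identifies `R/ker aug ⊗ R^b` with `k^b`. -/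
noncomputable def tensorFree (aug : R →ₐ[k] k) (b : ℕ) :
    TensorProduct R (R ⧸ RingHom.ker aug) (Fin b → R) ≃ₗ[k] (Fin b → k) :=
  ((TensorProduct.piScalarRight R R (R ⧸ RingHom.ker aug) (Fin b)).restrictScalars k).trans
    (LinearEquiv.piCongrRight fun _ =>
      (Ideal.quotientKerAlgEquivOfSurjective (f := aug)
        (fun c => ⟨algebraMap k R c, by simp⟩)).toLinearEquiv)

lemma tensorFree_tmul (aug : R →ₐ[k] k) (b : ℕ) (r : R) (v : Fin b → R) :
    tensorFree aug b (Ideal.Quotient.mk _ r ⊗ₜ v) = fun j => aug r * aug (v j) := by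
  ext j
  simp only [tensorFree, LinearEquiv.trans_apply, LinearEquiv.restrictScalars_apply,
    TensorProduct.piScalarRight_apply, TensorProduct.piScalarRightHom_tmul,
    LinearEquiv.piCongrRight_apply]
  rw [← map_mul, mul_comm]
  rfl

lemma finrank_range_lTensor (aug : R →ₐ[k] k) {a b : ℕ} (d : (Fin a → R) →ₗ[R] (Fin b → R)) :
    Module.finrank k (LinearMap.range (LinearMap.lTensor (R ⧸ RingHom.ker aug) d)) =
      ((LinearMap.toMatrix' d).map aug).rank := by
  have hcomm : ∀ x, tensorFree aug b (LinearMap.lTensor (R ⧸ RingHom.ker aug) d x) =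
      ((LinearMap.toMatrix' d).map aug).mulVecLin (tensorFree aug a x) := by
    intro x
    induction x with
    | zero => simp
    | add x y hx hy => simp only [map_add, hx, hy]
    | tmul r v =>
      obtain ⟨r, rfl⟩ := Ideal.Quotient.mk_surjective r
      rw [LinearMap.lTensor_tmul, tensorFree_tmul, tensorFree_tmul]
      ext j
      rw [← LinearMap.toMatrix'_mulVec d v]
      simp only [Matrix.mulVec, dotProduct, map_sum, map_mul, Finset.mul_sum]
      exact Finset.sum_congr rfl fun _ _ => mul_left_comm ..
  have hr : (LinearMap.range ((LinearMap.lTensor (R ⧸ RingHom.ker aug) d).restrictScalars k)).map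
      (tensorFree aug b).toLinearMap =
        LinearMap.range ((LinearMap.toMatrix' d).map aug).mulVecLin := by
    ext y
    simp only [Submodule.mem_map, LinearMap.mem_range]
    constructor
    · rintro ⟨_, ⟨x, rfl⟩, rfl⟩
      exact ⟨_, (hcomm x).symm⟩
    · rintro ⟨z, rfl⟩
      refine ⟨_, ⟨(tensorFree aug a).symm z, rfl⟩, ?_⟩
      refine (hcomm _).trans ?_
      rw [LinearEquiv.apply_symm_apply]
  rw [Matrix.rank, ← hr]
  exact (LinearEquiv.finrank_map_eq (tensorFree aug b)
    (LinearMap.range ((LinearMap.lTensor (R ⧸ RingHom.ker aug) d).restrictScalars k))).symm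

end Dimension

namespace FreeResolution

variable {R : Type} [CommRing R] {M : Type} [AddCommGroup M] [Module R M]

/-- The complex `R/J ⊗ L`. -/
noncomputable def tensorCpx (L : FreeResolution R M) (J : Ideal R) : ChainComplex (ModuleCat R) ℕ :=
  ((((MonoidalCategory.tensoringLeft (ModuleCat R)).obj
    (ModuleCat.of R (R ⧸ J))).mapHomologicalComplex _).obj L.cpx)

/-- `Tor_i(R/J, M)` is the homology of `R/J ⊗ L`. -/
noncomputable def torIso (L : FreeResolution R M) (J : Ideal R) (i : ℕ) :
    torQuotient R J (ModuleCat.of R M) i ≅ (L.tensorCpx J).homology i :=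
  L.toProjectiveResolution.isoLeftDerivedObj _ i

lemma tensorCpx_d (L : FreeResolution R M) (J : Ideal R) (i : ℕ) :
    (L.tensorCpx J).d (i + 1) i = ModuleCat.ofHom (LinearMap.lTensor (R ⧸ J) (L.d i)) := by
  change ((MonoidalCategory.tensoringLeft (ModuleCat R)).obj
    (ModuleCat.of R (R ⧸ J))).map (L.cpx.d (i + 1) i) = _
  rw [cpx_d]
  rfl

lemma lTensor_comp_eq_zero (L : FreeResolution R M) (J : Ideal R) (i : ℕ) :
    LinearMap.lTensor (R ⧸ J) (L.d i) ∘ₗ LinearMap.lTensor (R ⧸ J) (L.d (i + 1)) = 0 := by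
  rw [← LinearMap.lTensor_comp, (L.exact_succ i).linearMap_comp_eq_zero, LinearMap.lTensor_zero]

/-- Short complexes with equal maps are isomorphic. -/
def isoOfEq {X Y Z : ModuleCat.{0} R} {f f' : X ⟶ Y} {g g' : Y ⟶ Z} (w : f ≫ g = 0)
    (hf : f = f') (hg : g = g') :
    ShortComplex.mk f g w ≅ ShortComplex.mk f' g' (hf ▸ hg ▸ w) :=
  eqToIso (by subst hf hg; rfl)

/-- `Tor_(i+1)(R/J, M)` as the homology of a short complex of linear maps. -/
noncomputable def torIsoSucc (L : FreeResolution R M) (J : Ideal R) (i : ℕ) :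
    torQuotient R J (ModuleCat.of R M) (i + 1) ≅
      (ShortComplex.moduleCatMk _ _ (L.lTensor_comp_eq_zero J i)).homology :=
  L.torIso J (i + 1) ≪≫ ShortComplex.homologyMapIso
    ((L.tensorCpx J).isoSc' (i + 1 + 1) (i + 1) i (by simp) (by simp) ≪≫
      isoOfEq ((L.tensorCpx J).d_comp_d _ _ _) (L.tensorCpx_d J (i + 1)) (L.tensorCpx_d J i))

/-- `Tor_0(R/J, M)` as the homology of a short complex of linear maps. -/
noncomputable def torIsoZero (L : FreeResolution R M) (J : Ideal R) :
    torQuotient R J (ModuleCat.of R M) 0 ≅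
      (ShortComplex.moduleCatMk (LinearMap.lTensor (R ⧸ J) (L.d 0))
        (0 : _ →ₗ[R] TensorProduct R (R ⧸ J) (Fin (L.b 0) → R)) (LinearMap.zero_comp _)).homology :=
  L.torIso J 0 ≪≫ ShortComplex.homologyMapIso
    ((L.tensorCpx J).isoSc' 1 0 0 (by simp) (by simp) ≪≫
      isoOfEq ((L.tensorCpx J).d_comp_d _ _ _) (L.tensorCpx_d J 0)
        ((L.tensorCpx J).shape 0 0 (by simp)))

variable {k : Type} [Field k] [Algebra k R]

lemma finite_tensor (aug : R →ₐ[k] k) (b : ℕ) :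
    Module.Finite k (TensorProduct R (R ⧸ RingHom.ker aug) (Fin b → R)) :=
  Module.Finite.equiv (tensorFree aug b).symm

lemma finrank_tensor (aug : R →ₐ[k] k) (b : ℕ) :
    Module.finrank k (TensorProduct R (R ⧸ RingHom.ker aug) (Fin b → R)) = b := by
  rw [(tensorFree aug b).finrank_eq, Module.finrank_fin_fun]

lemma finrank_tor_succ (L : FreeResolution R M) (aug : R →ₐ[k] k) (i : ℕ) :
    Module.Finite k (TorQuotient k R (RingHom.ker aug) (ModuleCat.of R M) (i + 1)) ∧
    Module.finrank k (TorQuotient k R (RingHom.ker aug) (ModuleCat.of R M) (i + 1)) +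
      L.rk (aug : R →+* k) (i + 1) + L.rk (aug : R →+* k) i = L.b (i + 1) := by
  have := finite_tensor aug (L.b (i + 1))
  have h := finrank_homology (k := k)
    (H := TorQuotient k R (RingHom.ker aug) (ModuleCat.of R M) (i + 1))
    (LinearMap.lTensor (R ⧸ RingHom.ker aug) (L.d (i + 1)))
    (LinearMap.lTensor (R ⧸ RingHom.ker aug) (L.d i))
    (fun x => LinearMap.congr_fun (L.lTensor_comp_eq_zero (RingHom.ker aug) i) x)
    (L.torIsoSucc (RingHom.ker aug) i ≪≫ ShortComplex.moduleCatHomologyIso _).toLinearEquiv.symm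
  rw [finrank_range_lTensor, finrank_range_lTensor, finrank_tensor] at h
  exact h

lemma finrank_tor_zero (L : FreeResolution R M) (aug : R →ₐ[k] k) :
    Module.Finite k (TorQuotient k R (RingHom.ker aug) (ModuleCat.of R M) 0) ∧
    Module.finrank k (TorQuotient k R (RingHom.ker aug) (ModuleCat.of R M) 0) +
      L.rk (aug : R →+* k) 0 = L.b 0 := by
  have := finite_tensor aug (L.b 0)
  have h := finrank_homology (k := k) (H := TorQuotient k R (RingHom.ker aug) (ModuleCat.of R M) 0)
    (LinearMap.lTensor (R ⧸ RingHom.ker aug) (L.d 0))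
    (0 : _ →ₗ[R] TensorProduct R (R ⧸ RingHom.ker aug) (Fin (L.b 0) → R))
    (fun x => rfl)
    (L.torIsoZero (RingHom.ker aug) ≪≫ ShortComplex.moduleCatHomologyIso _).toLinearEquiv.symm
  rw [finrank_range_lTensor, finrank_tensor] at h
  refine ⟨h.1, ?_⟩
  have h0 : Module.finrank k (LinearMap.range
    (0 : TensorProduct R (R ⧸ RingHom.ker aug) (Fin (L.b 0) → R) →ₗ[R]
      TensorProduct R (R ⧸ RingHom.ker aug) (Fin (L.b 0) → R))) = 0 := by
    rw [LinearMap.range_zero]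
    exact Module.finrank_zero_of_subsingleton
  rw [h0] at h
  exact h.2

end FreeResolution

namespace FreeResolution

variable {R : Type} [CommRing R]

/-- Finitely generated modules over Noetherian rings have resolutions by finite free modules. -/
theorem nonempty_of_isNoetherianRing [IsNoetherianRing R] (M : Type) [AddCommGroup M] [Module R M]
    [Module.Finite R M] : Nonempty (FreeResolution R M) := by
  choose n f hf using fun s : (Σ a : ℕ, Submodule R (Fin a → R)) => Module.Finite.exists_fin' R s.2
  obtain ⟨b₀, ε, hε⟩ := Module.Finite.exists_fin' R M
  let s : ℕ → Σ a : ℕ, Submodule R (Fin a → R) := fun i =>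
    Nat.rec ⟨b₀, LinearMap.ker ε⟩ (fun _ t => ⟨n t, LinearMap.ker (f t)⟩) i
  have hr : ∀ i, LinearMap.range ((s i).2.subtype ∘ₗ f (s i)) = (s i).2 := fun i => by
    rw [LinearMap.range_comp, LinearMap.range_eq_top.2 (hf _), Submodule.map_top,
      Submodule.range_subtype]
  have hk : ∀ i, LinearMap.ker ((s i).2.subtype ∘ₗ f (s i)) = LinearMap.ker (f (s i)) := fun i => by
    rw [LinearMap.ker_comp, Submodule.ker_subtype]
    rfl
  exact ⟨{
    b := fun i => (s i).1
    d := fun i => (s i).2.subtype ∘ₗ f (s i)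
    ε := ε
    surjective := hε
    exact_zero := LinearMap.exact_iff.2 (hr 0).symm
    exact_succ := fun i => LinearMap.exact_iff.2 ((hk i).trans (hr (i + 1)).symm) }⟩

/-- Prepending `R` to a resolution of an ideal `J` resolves `R/J`. -/
noncomputable def cons {J : Ideal R} (L : FreeResolution R J) : FreeResolution R (R ⧸ J) where
  b := fun i => Nat.casesOn i 1 L.b
  d := fun i => Nat.casesOn i
    (LinearMap.pi fun _ : Fin 1 => J.subtype ∘ₗ L.ε) L.d
  ε := J.mkQ ∘ₗ LinearMap.proj (0 : Fin 1)
  surjective := (Submodule.mkQ_surjective J).comp fun x => ⟨fun _ => x, rfl⟩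
  exact_zero := by
    intro v
    change Submodule.Quotient.mk (v (0 : Fin 1)) = 0 ↔ _
    rw [Submodule.Quotient.mk_eq_zero]
    constructor
    · intro h
      obtain ⟨u, hu⟩ := L.surjective ⟨_, h⟩
      refine ⟨u, funext fun j => ?_⟩
      exact (congrArg Subtype.val hu).trans (congrArg v (Subsingleton.elim (α := Fin 1) 0 j))
    · rintro ⟨u, rfl⟩
      exact (L.ε u).2
  exact_succ := fun i => by
    cases i with
    | zero =>
      intro v
      rw [← L.exact_zero v]
      constructor
      · intro h
        exact Subtype.ext (congrFun h (0 : Fin 1))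
      · intro h
        refine funext fun j => ?_
        exact congrArg Subtype.val h
    | succ i => exact L.exact_succ i

variable {k : Type} [Field k] [Algebra k R]

lemma rk_cons_zero (aug : R →ₐ[k] k) (L : FreeResolution R (RingHom.ker aug)) :
    L.cons.rk (aug : R →+* k) 0 = 0 := by
  have h : (LinearMap.toMatrix' (L.cons.d 0)).map (aug : R →+* k) = 0 := by
    ext i j
    rw [Matrix.map_apply, LinearMap.toMatrix'_apply]
    exact (L.ε (Pi.single j 1)).2
  rw [rk, h, Matrix.rank_zero]

theorem finrank_tor_quotient_zero [IsNoetherianRing R] (aug : R →ₐ[k] k) :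
    Module.finrank k (TorQuotient k R (RingHom.ker aug) (ModuleCat.of R (R ⧸ RingHom.ker aug)) 0)
      = 1 := by
  obtain ⟨L⟩ := nonempty_of_isNoetherianRing (R := R) (RingHom.ker aug)
  have h := (L.cons.finrank_tor_zero aug).2
  rw [rk_cons_zero] at h
  exact h

theorem finrank_tor_quotient_succ [IsNoetherianRing R] (aug : R →ₐ[k] k) (i : ℕ) :
    Module.finrank k
      (TorQuotient k R (RingHom.ker aug) (ModuleCat.of R (R ⧸ RingHom.ker aug)) (i + 1)) =
    Module.finrank k
      (TorQuotient k R (RingHom.ker aug) (ModuleCat.of R (RingHom.ker aug)) i) := by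
  obtain ⟨L⟩ := nonempty_of_isNoetherianRing (R := R) (RingHom.ker aug)
  have h := (L.cons.finrank_tor_succ aug i).2
  cases i with
  | zero =>
    have h' := (L.finrank_tor_zero aug).2
    rw [rk_cons_zero] at h
    change _ + L.rk (aug : R →+* k) 0 + 0 = L.b 0 at h
    omega
  | succ i =>
    have h' := (L.finrank_tor_succ aug i).2
    change _ + L.rk (aug : R →+* k) (i + 1) + L.rk (aug : R →+* k) i = L.b (i + 1) at h
    omega

theorem finite_tor [IsNoetherianRing R] (aug : R →ₐ[k] k) (M : Type) [AddCommGroup M] [Module R M]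
    [Module.Finite R M] (i : ℕ) :
    Module.Finite k (TorQuotient k R (RingHom.ker aug) (ModuleCat.of R M) i) := by
  obtain ⟨L⟩ := nonempty_of_isNoetherianRing (R := R) M
  cases i with
  | zero => exact (L.finrank_tor_zero aug).1
  | succ i => exact (L.finrank_tor_succ aug i).1

section BaseChange

variable {S : Type} [CommRing S] {M N : Type} [AddCommGroup M] [Module R M]
  [AddCommGroup N] [Module S N]

lemma toLin'_map_apply (π : R →+* S) {a b : ℕ} (d : (Fin a → R) →ₗ[R] (Fin b → R))
    (v : Fin a → R) :
    Matrix.toLin' ((LinearMap.toMatrix' d).map π) (π ∘ v) = π ∘ d v := by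
  ext j
  rw [Matrix.toLin'_apply, ← RingHom.map_mulVec, LinearMap.toMatrix'_mulVec]
  rfl

lemma exists_smul_of_comp_eq_zero {π : R →+* S} {f : R} (hker : ∀ x, π x = 0 → ∃ y, x = f * y)
    {a : ℕ} {v : Fin a → R} (hv : π ∘ v = 0) : ∃ u : Fin a → R, v = f • u := by
  choose u hu using fun j => hker (v j) (congrFun hv j)
  exact ⟨u, funext hu⟩

lemma constr_comp_apply {π : R →+* S} (φ : M →ₛₗ[π] N) {a : ℕ} (ε : (Fin a → R) →ₗ[R] M)
    (v : Fin a → R) :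
    (Pi.basisFun S (Fin a)).constr S (fun j => φ (ε (Pi.single j 1))) (π ∘ v) = φ (ε v) := by
  conv_rhs => rw [← (Pi.basisFun R (Fin a)).sum_repr v]
  simp [Module.Basis.constr_apply_fintype]

lemma exists_comp_eq {π : R →+* S} (hπ : Function.Surjective π) {a : ℕ} (w : Fin a → S) :
    ∃ v : Fin a → R, π ∘ v = w := by
  choose v hv using fun j => hπ (w j)
  exact ⟨v, funext hv⟩

/-- Base change of a resolution of a torsion-free module along `R → S = R/(f)`, where `f` is
regular. -/
noncomputable def baseChange (L : FreeResolution R M) (π : R →+* S) (hπ : Function.Surjective π)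
    (f : R) (hker : ∀ x, π x = 0 → ∃ y, x = f * y) (hf : π f = 0)
    (hreg : ∀ x, f * x = 0 → x = 0) (hM : ∀ x : M, f • x = 0 → x = 0)
    (φ : M →ₛₗ[π] N) (hφ : Function.Surjective φ) (hφker : ∀ x, φ x = 0 → ∃ y, x = f • y) :
    FreeResolution S N where
  b := L.b
  d := fun i => Matrix.toLin' ((LinearMap.toMatrix' (L.d i)).map π)
  ε := (Pi.basisFun S (Fin (L.b 0))).constr S fun j => φ (L.ε (Pi.single j 1))
  surjective := fun y => by
    obtain ⟨x, rfl⟩ := hφ y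
    obtain ⟨v, rfl⟩ := L.surjective x
    exact ⟨π ∘ v, constr_comp_apply φ L.ε v⟩
  exact_zero := fun w => by
    obtain ⟨v, rfl⟩ := exists_comp_eq hπ w
    rw [constr_comp_apply]
    constructor
    · intro h
      obtain ⟨x, hx⟩ := hφker _ h
      obtain ⟨u, rfl⟩ := L.surjective x
      obtain ⟨z, hz⟩ := (L.exact_zero (v - f • u)).1 (by rw [map_sub, map_smul, hx, sub_self])
      refine ⟨π ∘ z, ?_⟩
      rw [toLin'_map_apply, hz]
      ext j
      simp [hf]
    · rintro ⟨z, hz⟩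
      obtain ⟨z, rfl⟩ := exists_comp_eq hπ z
      rw [toLin'_map_apply] at hz
      obtain ⟨u, hu⟩ := exists_smul_of_comp_eq_zero hker (v := v - L.d 0 z)
        (by ext j; simpa [sub_eq_zero] using (congrFun hz j).symm)
      have h := congrArg L.ε hu
      rw [map_sub, (L.exact_zero _).2 ⟨z, rfl⟩, sub_zero, map_smul] at h
      rw [h, map_smulₛₗ, hf, zero_smul]
  exact_succ := fun i w => by
    obtain ⟨v, rfl⟩ := exists_comp_eq hπ w
    rw [toLin'_map_apply]
    constructor
    · intro h
      obtain ⟨u, hu⟩ := exists_smul_of_comp_eq_zero hker h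
      have hz : ∃ z, L.d i z = u := by
        cases i with
        | zero =>
          refine (L.exact_zero u).1 (hM _ ?_)
          rw [← map_smul, ← hu]
          exact (L.exact_zero _).2 ⟨v, rfl⟩
        | succ i =>
          refine (L.exact_succ i u).1 (funext fun j => hreg _ ?_)
          have h0 : L.d i (f • u) = 0 := by
            rw [← hu]
            exact (L.exact_succ i _).2 ⟨v, rfl⟩
          rw [map_smul] at h0
          exact congrFun h0 j
      obtain ⟨z, rfl⟩ := hz
      obtain ⟨y, hy⟩ := (L.exact_succ i (v - f • z)).1 (by rw [map_sub, map_smul, hu, sub_self])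
      refine ⟨π ∘ y, ?_⟩
      rw [toLin'_map_apply, hy]
      ext j
      simp [hf]
    · rintro ⟨z, hz⟩
      obtain ⟨z, rfl⟩ := exists_comp_eq hπ z
      rw [toLin'_map_apply] at hz
      obtain ⟨u, hu⟩ := exists_smul_of_comp_eq_zero hker (v := v - L.d (i + 1) z)
        (by ext j; simpa [sub_eq_zero] using (congrFun hz j).symm)
      have h := congrArg (L.d i) hu
      rw [map_sub, (L.exact_succ i _).2 ⟨z, rfl⟩, sub_zero, map_smul] at h
      rw [h]
      ext j
      simp [hf]

end BaseChange

end FreeResolution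

section Additivity

/-- Left derived functors of an additive functor are additive. -/
instance leftDerived_additive {C D : Type*} [Category* C] [Category* D] [Abelian C]
    [HasProjectiveResolutions C] [Abelian D] (F : C ⥤ D) [F.Additive] (n : ℕ) :
    (F.leftDerived n).Additive where
  map_add {X Y f g} := by
    let P := projectiveResolution X
    let Q := projectiveResolution Y
    rw [F.leftDerived_map_eq n f (ProjectiveResolution.lift f P Q)
        (ProjectiveResolution.lift_commutes f P Q),
      F.leftDerived_map_eq n g (ProjectiveResolution.lift g P Q)
        (ProjectiveResolution.lift_commutes g P Q),
      F.leftDerived_map_eq n (f + g)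
        (ProjectiveResolution.lift f P Q + ProjectiveResolution.lift g P Q) (by
          rw [Preadditive.add_comp, ProjectiveResolution.lift_commutes,
            ProjectiveResolution.lift_commutes, Functor.map_add, Preadditive.comp_add])]
    rw [Functor.map_add, Preadditive.add_comp, Preadditive.comp_add]

variable {k : Type} [Field k] {R : Type} [CommRing R] [Algebra k R]

/-- Betti numbers are additive in the module. -/
theorem finrank_tor_prod (J : Ideal R) (M N : Type) [AddCommGroup M] [Module R M]
    [AddCommGroup N] [Module R N] (i : ℕ)
    [Module.Finite k (TorQuotient k R J (ModuleCat.of R M) i)]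
    [Module.Finite k (TorQuotient k R J (ModuleCat.of R N) i)] :
    Module.finrank k (TorQuotient k R J (ModuleCat.of R (M × N)) i) =
      Module.finrank k (TorQuotient k R J (ModuleCat.of R M) i) +
        Module.finrank k (TorQuotient k R J (ModuleCat.of R N) i) := by
  let F : ModuleCat.{0} R ⥤ ModuleCat.{0} R :=
    ((MonoidalCategory.tensoringLeft (ModuleCat R)).obj (ModuleCat.of R (R ⧸ J))).leftDerived i
  have : F.Additive := leftDerived_additive _ i
  have : Limits.PreservesBinaryBiproducts F :=
    Limits.preservesBinaryBiproducts_of_preservesBiproducts F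
  let e := F.mapIso (ModuleCat.biprodIsoProd (ModuleCat.of R M) (ModuleCat.of R N)).symm ≪≫
    F.mapBiprod (ModuleCat.of R M) (ModuleCat.of R N) ≪≫ ModuleCat.biprodIsoProd _ _
  let e' : TorQuotient k R J (ModuleCat.of R (M × N)) i ≃ₗ[R]
      TorQuotient k R J (ModuleCat.of R M) i × TorQuotient k R J (ModuleCat.of R N) i :=
    e.toLinearEquiv
  rw [(e'.restrictScalars k).finrank_eq, Module.finrank_prod]

end Additivity

section RegularElement

variable {k : Type} [Field k] {R S : Type} [CommRing R] [CommRing S] [Algebra k R] [Algebra k S]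

omit [Algebra k R] [Algebra k S] in
lemma FreeResolution.rk_baseChange {M N : Type} [AddCommGroup M] [Module R M]
    [AddCommGroup N] [Module S N] (L : FreeResolution R M) (π : R →+* S)
    (hπ : Function.Surjective π)
    (f : R) (hker : ∀ x, π x = 0 → ∃ y, x = f * y) (hf : π f = 0)
    (hreg : ∀ x, f * x = 0 → x = 0) (hM : ∀ x : M, f • x = 0 → x = 0)
    (φ : M →ₛₗ[π] N) (hφ : Function.Surjective φ) (hφker : ∀ x, φ x = 0 → ∃ y, x = f • y)
    (aug : S →+* k) (i : ℕ) :
    (L.baseChange π hπ f hker hf hreg hM φ hφ hφker).rk aug i = L.rk (aug.comp π) i := by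
  unfold FreeResolution.rk FreeResolution.baseChange
  rw [LinearMap.toMatrix'_toLin']
  rfl

lemma exists_linearMap_eq_one_of_notMem_ker_sq (aug : R →ₐ[k] k) {f : R} (hf2 : f ∉ RingHom.ker aug ^ 2) :
    ∃ l : R →ₗ[k] k, l f = 1 ∧ ∀ r x, aug x = 0 → l (r * x) = aug r * l x := by
  obtain ⟨l, hl, hle⟩ := Submodule.exists_le_ker_of_notMem
    (p := ((RingHom.ker aug ^ 2 : Ideal R).restrictScalars k)) (v := f)
    fun h => hf2 ((Submodule.restrictScalars_mem k _ _).1 h)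
  refine ⟨(l f)⁻¹ • l, by simp [hl], fun r x hx => ?_⟩
  have h : (r - algebraMap k R (aug r)) * x ∈ RingHom.ker aug ^ 2 := by
    rw [pow_two]
    exact Ideal.mul_mem_mul (by simp [RingHom.mem_ker]) hx
  have h2 : l ((r - algebraMap k R (aug r)) * x) = 0 := hle h
  rw [sub_mul, map_sub, sub_eq_zero, ← Algebra.smul_def, map_smul, smul_eq_mul] at h2
  simp only [LinearMap.smul_apply, h2, smul_eq_mul]
  ring

/-- Nagata's formula for the Betti numbers of the residue field modulo a regular element outside
the square of the maximal ideal. -/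
theorem finrank_tor_quotient_regular [IsNoetherianRing R] (aug : S →ₐ[k] k) (π : R →ₐ[k] S)
    (hπ : Function.Surjective π) (f : R) (hker : ∀ x, π x = 0 → ∃ y, x = f * y) (hf : π f = 0)
    (hreg : ∀ x, f * x = 0 → x = 0) (hf2 : f ∉ RingHom.ker (aug.comp π) ^ 2) (i : ℕ) :
    Module.finrank k (TorQuotient k R (RingHom.ker (aug.comp π))
      (ModuleCat.of R (R ⧸ RingHom.ker (aug.comp π))) (i + 1)) =
    Module.finrank k (TorQuotient k S (RingHom.ker aug)
      (ModuleCat.of S (S ⧸ RingHom.ker aug)) i) +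
    Module.finrank k (TorQuotient k S (RingHom.ker aug)
      (ModuleCat.of S (S ⧸ RingHom.ker aug)) (i + 1)) := by
  have : IsNoetherianRing S := isNoetherianRing_of_surjective R S (π : R →+* S) hπ
  have hfm : (aug.comp π) f = 0 := by simp [hf]
  obtain ⟨l, hl1, hl⟩ := exists_linearMap_eq_one_of_notMem_ker_sq (aug.comp π) hf2
  have halg : ∀ s : S, algebraMap k (S ⧸ RingHom.ker aug) (aug s) =
      Ideal.Quotient.mk (RingHom.ker aug) s := fun s => by
    rw [IsScalarTower.algebraMap_apply k S (S ⧸ RingHom.ker aug), Ideal.Quotient.algebraMap_eq,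
      Ideal.Quotient.eq]
    simp [RingHom.mem_ker]
  let φ : RingHom.ker (aug.comp π) →ₛₗ[(π : R →+* S)] (S ⧸ RingHom.ker aug) × RingHom.ker aug :=
    { toFun := fun x => (algebraMap k (S ⧸ RingHom.ker aug) (l x), ⟨π x, x.2⟩)
      map_add' := fun x y => by ext <;> simp
      map_smul' := fun r x => by
        refine Prod.ext ?_ (Subtype.ext ?_)
        · change algebraMap k (S ⧸ RingHom.ker aug) (l (r * x)) =
            π r • algebraMap k (S ⧸ RingHom.ker aug) (l x)
          rw [hl r x x.2, map_mul, Algebra.smul_def, Ideal.Quotient.algebraMap_eq, ← halg]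
          rfl
        · exact map_mul π r x }
  have hφ : Function.Surjective φ := by
    rintro ⟨a, c, hc⟩
    obtain ⟨s, rfl⟩ := Ideal.Quotient.mk_surjective a
    obtain ⟨x, rfl⟩ := hπ c
    have hmem : x + algebraMap k R (aug s - l x) * f ∈ RingHom.ker (aug.comp π) :=
      Ideal.add_mem _ hc (Ideal.mul_mem_left _ _ hfm)
    refine ⟨⟨_, hmem⟩, Prod.ext ?_ (Subtype.ext ?_)⟩
    · change algebraMap k (S ⧸ RingHom.ker aug) (l (x + algebraMap k R (aug s - l x) * f)) = _
      rw [← Algebra.smul_def, map_add, map_smul, hl1, smul_eq_mul, mul_one, add_sub_cancel, halg]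
    · change π (x + algebraMap k R (aug s - l x) * f) = π x
      rw [map_add, map_mul, hf, mul_zero, add_zero]
  have hφker : ∀ x, φ x = 0 → ∃ y, x = f • y := by
    rintro ⟨x, hx⟩ h
    obtain ⟨y, rfl⟩ := hker x (congrArg (fun z => (z.2 : S)) h)
    have h1 : algebraMap k (S ⧸ RingHom.ker aug) (l (f * y)) = 0 := congrArg Prod.fst h
    rw [mul_comm, hl y f hfm, hl1, mul_one, AlgHom.comp_apply, halg, Ideal.Quotient.eq_zero_iff_mem]
      at h1
    exact ⟨⟨y, h1⟩, rfl⟩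
  obtain ⟨L⟩ := FreeResolution.nonempty_of_isNoetherianRing (R := R) (RingHom.ker (aug.comp π))
  have hM : ∀ x : RingHom.ker (aug.comp π), f • x = 0 → x = 0 := fun x hx =>
    Subtype.ext (hreg _ (congrArg Subtype.val hx))
  let L' := L.baseChange (π : R →+* S) hπ f hker hf hreg hM φ hφ hφker
  have hrk : ∀ j, L'.rk (aug : S →+* k) j = L.rk ((aug.comp π : R →ₐ[k] k) : R →+* k) j := fun j =>
    L.rk_baseChange (π : R →+* S) hπ f hker hf hreg hM φ hφ hφker (aug : S →+* k) j
  have h1 := FreeResolution.finite_tor aug (S ⧸ RingHom.ker aug) i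
  have h2 := FreeResolution.finite_tor aug (RingHom.ker aug) i
  rw [FreeResolution.finrank_tor_quotient_succ, FreeResolution.finrank_tor_quotient_succ,
    ← finrank_tor_prod]
  cases i with
  | zero =>
    have h3 := (L.finrank_tor_zero (aug.comp π)).2
    have h4 := (L'.finrank_tor_zero aug).2
    rw [hrk] at h4
    change _ = L.b 0 at h4
    omega
  | succ i =>
    have h3 := (L.finrank_tor_succ (aug.comp π) i).2
    have h4 := (L'.finrank_tor_succ aug i).2
    rw [hrk, hrk] at h4
    change _ = L.b (i + 1) at h4
    omega

/-- Two quotients of a ring by regular elements outside the square of the maximal ideal have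
the same Betti numbers. -/
theorem finrank_tor_quotient_eq {T : Type} [CommRing T] [Algebra k T]
    [IsNoetherianRing R] (aug₁ : S →ₐ[k] k) (aug₂ : T →ₐ[k] k) (π₁ : R →ₐ[k] S) (π₂ : R →ₐ[k] T)
    (haug : aug₁.comp π₁ = aug₂.comp π₂)
    (hπ₁ : Function.Surjective π₁) (f : R) (hker₁ : ∀ x, π₁ x = 0 → ∃ y, x = f * y)
    (hf : π₁ f = 0) (hregf : ∀ x, f * x = 0 → x = 0)
    (hf2 : f ∉ RingHom.ker (aug₁.comp π₁) ^ 2)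
    (hπ₂ : Function.Surjective π₂) (g : R) (hker₂ : ∀ x, π₂ x = 0 → ∃ y, x = g * y)
    (hg : π₂ g = 0) (hregg : ∀ x, g * x = 0 → x = 0)
    (hg2 : g ∉ RingHom.ker (aug₁.comp π₁) ^ 2) (i : ℕ) :
    Module.finrank k (TorQuotient k S (RingHom.ker aug₁)
      (ModuleCat.of S (S ⧸ RingHom.ker aug₁)) i) =
    Module.finrank k (TorQuotient k T (RingHom.ker aug₂)
      (ModuleCat.of T (T ⧸ RingHom.ker aug₂)) i) := by
  have : IsNoetherianRing S := isNoetherianRing_of_surjective R S (π₁ : R →+* S) hπ₁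
  have : IsNoetherianRing T := isNoetherianRing_of_surjective R T (π₂ : R →+* T) hπ₂
  induction i with
  | zero =>
    rw [FreeResolution.finrank_tor_quotient_zero, FreeResolution.finrank_tor_quotient_zero]
  | succ i ih =>
    have h1 := finrank_tor_quotient_regular aug₁ π₁ hπ₁ f hker₁ hf hregf hf2 i
    have h2 := finrank_tor_quotient_regular aug₂ π₂ hπ₂ g hker₂ hg hregg (haug ▸ hg2) i
    rw [← haug] at h2
    omega

end RegularElement

section Algebra

variable {k : Type} [Field k] {σ : Type}

lemma idealOfVars_eq_ker_aeval_zero :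
    idealOfVars σ k = RingHom.ker (aeval (fun _ => 0) : MvPolynomial σ k →ₐ[k] k) := by
  ext p
  rw [RingHom.mem_ker, ← pow_one (idealOfVars σ k), mem_pow_idealOfVars_iff']
  have h : aeval (fun _ : σ => (0 : k)) p = p.coeff 0 := by
    rw [← constantCoeff_eq]
    simp [aeval_def, eval₂_zero'_apply, constantCoeff]
  simp only [h, Nat.lt_one_iff, Finsupp.degree_eq_zero_iff, forall_eq]

lemma X_notMem_idealOfVars_sq (i : σ) : (X i : MvPolynomial σ k) ∉ idealOfVars σ k ^ 2 := by
  rw [X, monomial_mem_pow_idealOfVars_iff _ _ one_ne_zero]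
  simp

/-- The augmentation `X j ↦ 0` of a quotient of a polynomial ring. -/
noncomputable def quotientAug (I : Ideal (MvPolynomial σ k)) (hI : I ≤ idealOfVars σ k) :
    (MvPolynomial σ k ⧸ I) →ₐ[k] k :=
  Ideal.Quotient.liftₐ I (aeval fun _ => 0) fun a ha => by
    have := hI ha
    rwa [idealOfVars_eq_ker_aeval_zero] at this

lemma ker_quotientAug (I : Ideal (MvPolynomial σ k)) (hI : I ≤ idealOfVars σ k) :
    RingHom.ker (quotientAug I hI) = (idealOfVars σ k).map (Ideal.Quotient.mk I) := by
  have h : RingHom.ker (aeval (fun _ => 0) : MvPolynomial σ k →ₐ[k] k) =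
      (RingHom.ker (quotientAug I hI)).comap (Ideal.Quotient.mk I) := by
    ext p
    rfl
  rw [idealOfVars_eq_ker_aeval_zero, h,
    Ideal.map_comap_of_surjective _ Ideal.Quotient.mk_surjective]

lemma mk_X_notMem_ker_quotientAug_sq (I : Ideal (MvPolynomial σ k)) (hI : I ≤ idealOfVars σ k)
    (hI2 : I ≤ idealOfVars σ k ^ 2) (i : σ) :
    Ideal.Quotient.mk I (X i) ∉ RingHom.ker (quotientAug I hI) ^ 2 := by
  rw [ker_quotientAug, ← Ideal.map_pow, ← Ideal.mem_comap,
    Ideal.comap_map_of_surjective _ Ideal.Quotient.mk_surjective, ← RingHom.ker_eq_comap_bot,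
    Ideal.mk_ker, sup_eq_left.2 hI2]
  exact X_notMem_idealOfVars_sq i

lemma polynomial_X_notMem_ker_sq {B : Type} [CommRing B] [Algebra k B] (aug : B →ₐ[k] k) :
    (Polynomial.X : Polynomial B) ∉
      RingHom.ker (aug.comp (Polynomial.aevalTower (AlgHom.id k B) 0)) ^ 2 := by
  intro h
  have h1 := Ideal.mem_map_of_mem (Polynomial.mapAlgHom aug) h
  have h2 : (RingHom.ker (aug.comp (Polynomial.aevalTower (AlgHom.id k B) 0))).map
      (Polynomial.mapAlgHom aug) ≤ Ideal.span {Polynomial.X} := by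
    rw [Ideal.map_le_iff_le_comap]
    intro p hp
    rw [RingHom.mem_ker] at hp
    rw [Ideal.mem_comap, Ideal.mem_span_singleton, Polynomial.X_dvd_iff]
    simpa [Polynomial.aevalTower, Polynomial.coeff_zero_eq_eval_zero] using hp
  rw [Ideal.map_pow] at h1
  have h3 := Ideal.pow_right_mono h2 2 h1
  rw [Ideal.span_singleton_pow, Ideal.mem_span_singleton, Polynomial.X_pow_dvd_iff] at h3
  simpa using h3 1 one_lt_two

/-- The substitution `X j ↦ X j ^ q` for `j ∈ s`, fixing the other variables. -/
noncomputable def powVars [DecidableEq σ] (q : ℕ) (s : Finset σ) :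
    MvPolynomial σ k →ₐ[k] MvPolynomial σ k :=
  aeval fun j => if j ∈ s then X j ^ q else X j

lemma map_powVars_le [DecidableEq σ] {q : ℕ} (hq : 0 < q) (s : Finset σ) (r : ℕ)
    {I : Ideal (MvPolynomial σ k)} (hI : I ≤ idealOfVars σ k ^ r) :
    I.map (powVars q s) ≤ idealOfVars σ k ^ r := by
  refine (Ideal.map_mono hI).trans ?_
  rw [Ideal.map_pow]
  refine Ideal.pow_right_mono ?_ r
  rw [Ideal.map_span, Ideal.span_le]
  rintro _ ⟨_, ⟨j, rfl⟩, rfl⟩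
  have hj : (X j : MvPolynomial σ k) ∈ idealOfVars σ k := Ideal.subset_span ⟨j, rfl⟩
  simp only [powVars, aeval_X, SetLike.mem_coe]
  split_ifs
  · exact Ideal.pow_mem_of_mem _ hj q hq
  · exact hj

lemma powVars_insert [DecidableEq σ] (q : ℕ) {s : Finset σ} {i : σ} (hi : i ∉ s) :
    (powVars q {i}).comp (powVars q s) =
      (powVars q (insert i s) : MvPolynomial σ k →ₐ[k] MvPolynomial σ k) := by
  ext1 j
  by_cases hj : j = i
  · subst hj
    simp [powVars, hi]
  · by_cases hs : j ∈ s <;> simp [powVars, hj, hs]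

lemma powVars_univ_monomial [DecidableEq σ] [Fintype σ] (q : ℕ) (m : σ →₀ ℕ) :
    powVars q Finset.univ (monomial m (1 : k)) = monomial m 1 ^ q := by
  rw [powVars, aeval_monomial, monomial_pow, one_pow, map_one, one_mul, monomial_eq, C_1, one_mul,
    Finsupp.prod_fintype _ _ (by simp), Finsupp.prod_fintype _ _ (by simp)]
  simp [← pow_mul]

section Deformation

variable [DecidableEq σ] (q : ℕ) (i : σ) {B B' : Type} [CommRing B] [Algebra k B] [CommRing B']
  [Algebra k B'] (π : MvPolynomial σ k →ₐ[k] B) (π' : MvPolynomial σ k →ₐ[k] B') (α : B →ₐ[k] B')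

/-- The map `A → B[T]` sending `X i` to `T` and the other variables to their images in `B`. -/
noncomputable def replaceVar : MvPolynomial σ k →ₐ[k] Polynomial B :=
  aeval fun j => if j = i then Polynomial.X else Polynomial.C (π (X j))

lemma aevalTower_replaceVar (hα : α.comp π = π'.comp (powVars q {i})) (p : MvPolynomial σ k) :
    Polynomial.aevalTower α (π' (X i)) (replaceVar i π p) = π' p := by
  suffices h : (Polynomial.aevalTower α (π' (X i))).comp (replaceVar i π) = π' from
    DFunLike.congr_fun h p
  refine MvPolynomial.algHom_ext fun j => ?_
  rw [AlgHom.comp_apply, replaceVar, aeval_X]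
  split_ifs with hj
  · rw [Polynomial.aevalTower_X, hj]
  · rw [Polynomial.aevalTower_C, ← AlgHom.comp_apply, hα, AlgHom.comp_apply, powVars, aeval_X,
      if_neg (by simpa using hj)]

lemma aevalTower_surjective (hα : α.comp π = π'.comp (powVars q {i}))
    (hπ' : Function.Surjective π') :
    Function.Surjective (Polynomial.aevalTower α (π' (X i))) := fun y => by
  obtain ⟨p, rfl⟩ := hπ' y
  exact ⟨_, aevalTower_replaceVar q i π π' α hα p⟩

lemma aevalTower_X_pow_sub (hα : α.comp π = π'.comp (powVars q {i})) :
    Polynomial.aevalTower α (π' (X i)) (Polynomial.X ^ q - Polynomial.C (π (X i))) = 0 := by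
  rw [map_sub, map_pow, Polynomial.aevalTower_X, Polynomial.aevalTower_C, ← AlgHom.comp_apply, hα,
    AlgHom.comp_apply, powVars, aeval_X, if_pos (Finset.mem_singleton_self i), map_pow, sub_self]

lemma mk_replaceVar_powVars (p : MvPolynomial σ k) :
    Ideal.Quotient.mk (Ideal.span {Polynomial.X ^ q - Polynomial.C (π (X i))})
      (replaceVar i π (powVars q {i} p)) = Ideal.Quotient.mk _ (Polynomial.C (π p)) := by
  let J : Ideal (Polynomial B) := Ideal.span {Polynomial.X ^ q - Polynomial.C (π (X i))}
  suffices h : ((Ideal.Quotient.mkₐ k J).comp (replaceVar i π)).comp (powVars q {i}) =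
      ((Ideal.Quotient.mkₐ k J).comp Polynomial.CAlgHom).comp π from
    DFunLike.congr_fun h p
  refine MvPolynomial.algHom_ext fun j => ?_
  change Ideal.Quotient.mk J _ = Ideal.Quotient.mk J (Polynomial.C (π (X j)))
  rw [Ideal.Quotient.eq]
  change replaceVar i π (powVars q {i} (X j)) - _ ∈ J
  by_cases hj : j = i
  · subst hj
    simp only [powVars, aeval_X, Finset.mem_singleton, if_true, map_pow, replaceVar]
    exact Ideal.subset_span rfl
  · simp [replaceVar, powVars, hj]

lemma eq_mul_of_aevalTower_eq_zero (hα : α.comp π = π'.comp (powVars q {i}))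
    (hπ : Function.Surjective π) (hπ' : Function.Surjective π')
    (hker : RingHom.ker π' = (RingHom.ker π).map (powVars q {i})) (x : Polynomial B)
    (hx : Polynomial.aevalTower α (π' (X i)) x = 0) :
    ∃ y, x = (Polynomial.X ^ q - Polynomial.C (π (X i))) * y := by
  let J : Ideal (Polynomial B) := Ideal.span {Polynomial.X ^ q - Polynomial.C (π (X i))}
  have hle : RingHom.ker π' ≤ RingHom.ker ((Ideal.Quotient.mkₐ k J).comp (replaceVar i π)) := by
    rw [hker, Ideal.map_le_iff_le_comap]
    intro p hp
    rw [Ideal.mem_comap, RingHom.mem_ker]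
    refine (mk_replaceVar_powVars q i π p).trans ?_
    rw [RingHom.mem_ker.1 hp, map_zero, map_zero]
  let ψ : B' →ₐ[k] Polynomial B ⧸ J := AlgHom.liftOfSurjective π' hπ' _ hle
  have hψ' : ∀ p, ψ (π' p) = Ideal.Quotient.mk J (replaceVar i π p) := fun p =>
    AlgHom.liftOfSurjective_apply ..
  have hψ : ψ.comp (Polynomial.aevalTower α (π' (X i))) = Ideal.Quotient.mkₐ k J := by
    refine Polynomial.algHom_ext' (AlgHom.ext fun b => ?_) ?_
    · obtain ⟨p, rfl⟩ := hπ b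
      refine Eq.trans ?_ (mk_replaceVar_powVars q i π p)
      rw [← hψ', ← AlgHom.comp_apply π', ← hα]
      simp
    · rw [AlgHom.comp_apply, Polynomial.aevalTower_X, hψ', replaceVar, aeval_X, if_pos rfl]
      rfl
  have h := DFunLike.congr_fun hψ x
  rw [AlgHom.comp_apply, hx, map_zero] at h
  exact Ideal.mem_span_singleton.1 (Ideal.Quotient.eq_zero_iff_mem.1 h.symm)

end Deformation

end Algebra

section MainTheorem

variable {k : Type} [Field k] {σ : Type}

/-- Betti numbers are invariant under the substitution `X i ↦ X i ^ q` in the relations. -/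
lemma finrank_tor_eq_of_map_powVars_singleton [DecidableEq σ] {q : ℕ} (hq : 0 < q) (i : σ)
    {B B' : Type} [CommRing B] [Algebra k B] [CommRing B'] [Algebra k B'] [IsNoetherianRing B]
    (π : MvPolynomial σ k →ₐ[k] B) (π' : MvPolynomial σ k →ₐ[k] B') (α : B →ₐ[k] B')
    (hα : α.comp π = π'.comp (powVars q {i})) (hπ : Function.Surjective π)
    (hπ' : Function.Surjective π') (hker : RingHom.ker π' = (RingHom.ker π).map (powVars q {i}))
    (aug : B →ₐ[k] k) (aug' : B' →ₐ[k] k) (haug : aug.comp π = aeval fun _ => 0)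
    (haug' : aug'.comp π' = aeval fun _ => 0) (hX : π (X i) ∉ RingHom.ker aug ^ 2) (j : ℕ) :
    Module.finrank k (TorQuotient k B (RingHom.ker aug)
      (ModuleCat.of B (B ⧸ RingHom.ker aug)) j) =
    Module.finrank k (TorQuotient k B' (RingHom.ker aug')
      (ModuleCat.of B' (B' ⧸ RingHom.ker aug')) j) := by
  let π₁ := Polynomial.aevalTower (AlgHom.id k B) 0
  let π₂ := Polynomial.aevalTower α (π' (X i))
  have hX' : aug' (π' (X i)) = 0 := by
    rw [← AlgHom.comp_apply, haug', aeval_X]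
  have hcomp : aug.comp π₁ = aug'.comp π₂ := by
    refine Polynomial.algHom_ext' (AlgHom.ext fun b => ?_) ?_
    · obtain ⟨p, rfl⟩ := hπ b
      suffices h : aug.comp π = (aug'.comp α).comp π by
        simpa [π₁, π₂] using DFunLike.congr_fun h p
      rw [AlgHom.comp_assoc, hα, ← AlgHom.comp_assoc, haug, haug']
      refine MvPolynomial.algHom_ext fun j => ?_
      by_cases hj : j = i <;> simp [powVars, hj, hq.ne']
    · simp [π₁, π₂, hX']
  have hmonic : (Polynomial.X ^ q - Polynomial.C (π (X i))).Monic :=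
    Polynomial.monic_X_pow_sub_C _ hq.ne'
  refine finrank_tor_quotient_eq aug aug' π₁ π₂ hcomp
    (fun b => ⟨Polynomial.C b, Polynomial.aevalTower_C ..⟩)
    Polynomial.X (fun x hx => Polynomial.X_dvd_iff.2 ?_) (Polynomial.aevalTower_X ..)
    (fun x hx => by simpa using hx) (polynomial_X_notMem_ker_sq aug)
    (aevalTower_surjective q i π π' α hα hπ') (Polynomial.X ^ q - Polynomial.C (π (X i)))
    (eq_mul_of_aevalTower_eq_zero q i π π' α hα hπ hπ' hker) (aevalTower_X_pow_sub q i π π' α hα)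
    (fun x hx => (hmonic.mul_right_eq_zero_iff).1 hx) (fun h => hX ?_) j
  · simpa [π₁, Polynomial.aevalTower, Polynomial.coeff_zero_eq_eval_zero] using hx
  · have h1 := Ideal.mem_map_of_mem π₁ h
    rw [Ideal.map_pow] at h1
    have h2 : (RingHom.ker (aug.comp π₁)).map π₁ ≤ RingHom.ker aug :=
      Ideal.map_le_iff_le_comap.2 fun p hp => hp
    have h3 := Ideal.pow_right_mono h2 2 h1
    rwa [map_sub, map_pow, Polynomial.aevalTower_X, Polynomial.aevalTower_C, zero_pow hq.ne',
      zero_sub, neg_mem_iff] at h3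

/-- Betti numbers are invariant under the substitution `X i ↦ X i ^ q`, `i ∈ s`, in the relations. -/
lemma finrank_tor_map_powVars [Finite σ] [DecidableEq σ] {q : ℕ} (hq : 0 < q) (s : Finset σ)
    (I I' : Ideal (MvPolynomial σ k)) (hI : I ≤ idealOfVars σ k) (hI' : I' ≤ idealOfVars σ k)
    (hI2 : I ≤ idealOfVars σ k ^ 2) (hII' : I' = I.map (powVars q s)) (j : ℕ) :
    Module.finrank k (TorQuotient k (MvPolynomial σ k ⧸ I) (RingHom.ker (quotientAug I hI))
      (ModuleCat.of _ (_ ⧸ RingHom.ker (quotientAug I hI))) j) =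
    Module.finrank k (TorQuotient k (MvPolynomial σ k ⧸ I') (RingHom.ker (quotientAug I' hI'))
      (ModuleCat.of _ (_ ⧸ RingHom.ker (quotientAug I' hI'))) j) := by
  induction s using Finset.induction_on generalizing I' with
  | empty =>
    have h : (powVars q ∅ : MvPolynomial σ k →ₐ[k] MvPolynomial σ k) = AlgHom.id k _ :=
      MvPolynomial.algHom_ext fun j => by simp [powVars]
    rw [h] at hII'
    obtain rfl : I' = I := hII'.trans (Ideal.map_id I)
    rfl
  | insert i s hi ih =>
    have h1 : I.map (powVars q s) ≤ idealOfVars σ k := by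
      simpa using map_powVars_le hq s 1 (by simpa using hI)
    rw [ih _ h1 rfl]
    have hI'' : I' = (I.map (powVars q s)).map (powVars q {i}) := by
      rw [hII', ← powVars_insert q hi]
      exact (Ideal.map_map _ _).symm
    have hker : ∀ J : Ideal (MvPolynomial σ k), RingHom.ker (Ideal.Quotient.mkₐ k J) = J :=
      fun J => Ideal.ext fun _ => Ideal.Quotient.eq_zero_iff_mem
    refine finrank_tor_eq_of_map_powVars_singleton hq i (Ideal.Quotient.mkₐ k _)
      (Ideal.Quotient.mkₐ k I')
      (Ideal.quotientMapₐ I' (powVars q {i}) (hI'' ▸ Ideal.le_comap_map))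
      (Ideal.quotient_map_comp_mkₐ ..) Ideal.Quotient.mk_surjective
      Ideal.Quotient.mk_surjective (by rw [hker, hker, hI'']) _ _ rfl rfl
      (mk_X_notMem_ker_quotientAug_sq _ h1 (map_powVars_le hq s 2 hI2) i) j

lemma resMax_eq_ker (n : ℕ) (I : Ideal (MvPolynomial (Fin n) k)) (hI : I ≤ idealOfVars (Fin n) k) :
    resMax k n I = RingHom.ker (quotientAug I hI) :=
  (ker_quotientAug I hI).symm

end MainTheorem

/-- Theorem 2.3: if `I ⊆ 𝔪_A²` is a monomial ideal and `I_q` is generated by the `q`-th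
powers of its minimal monomial generators, then for every `i` the `k`-vector spaces
`Tor_i^{A/I}(k,k)` and `Tor_i^{A/I_q}(k,k)` have the same finite dimension, i.e. the
Poincaré series of `A/I` and `A/I_q` coincide. -/
theorem poincare_series_eq_of_powers (k : Type) [Field k] (n t q : ℕ) (hq : 0 < q)
    (m : Fin t → (Fin n →₀ ℕ))
    (hmin : ∀ j j' : Fin t, m j ≤ m j' → j = j')
    (I Iq : Ideal (MvPolynomial (Fin n) k))
    (hI : I = Ideal.span (Set.range fun j => monomial (m j) (1 : k)))
    (hIq : Iq = Ideal.span (Set.range fun j => (monomial (m j) (1 : k)) ^ q))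
    (hI2 : I ≤ (Ideal.span (Set.range (X : Fin n → MvPolynomial (Fin n) k))) ^ 2) :
    ∀ i : ℕ,
      Module.Finite k (TorVS k (MvPolynomial (Fin n) k ⧸ I) (resMax k n I) i) ∧
      Module.Finite k (TorVS k (MvPolynomial (Fin n) k ⧸ Iq) (resMax k n Iq) i) ∧
      Module.rank k (TorVS k (MvPolynomial (Fin n) k ⧸ I) (resMax k n I) i) =
        Module.rank k (TorVS k (MvPolynomial (Fin n) k ⧸ Iq) (resMax k n Iq) i) := by
  intro i
  have hI1 : I ≤ idealOfVars (Fin n) k := hI2.trans (Ideal.pow_le_self two_ne_zero)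
  have hmap : Iq = I.map (powVars q Finset.univ) := by
    rw [hI, hIq, Ideal.map_span, ← Set.range_comp]
    congr 2
    exact funext fun j => (powVars_univ_monomial q (m j)).symm
  have hIq1 : Iq ≤ idealOfVars (Fin n) k := by
    simpa [hmap] using map_powVars_le hq Finset.univ 1 (by simpa using hI1)
  have h1 : Module.Finite k (TorVS k (MvPolynomial (Fin n) k ⧸ I) (resMax k n I) i) := by
    rw [resMax_eq_ker n I hI1]
    exact FreeResolution.finite_tor (quotientAug I hI1) (_ ⧸ RingHom.ker (quotientAug I hI1)) i
  have h2 : Module.Finite k (TorVS k (MvPolynomial (Fin n) k ⧸ Iq) (resMax k n Iq) i) := by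
    rw [resMax_eq_ker n Iq hIq1]
    exact FreeResolution.finite_tor (quotientAug Iq hIq1) (_ ⧸ RingHom.ker (quotientAug Iq hIq1)) i
  refine ⟨h1, h2, ?_⟩
  rw [← Module.finrank_eq_rank, ← Module.finrank_eq_rank, resMax_eq_ker n I hI1,
    resMax_eq_ker n Iq hIq1]
  exact congrArg _ (finrank_tor_map_powVars hq Finset.univ I Iq hI1 hIq1 hI2 hmap i)
end

section
/- Let I ⊆ A be a squarefree monomial ideal, q a positive integer, and let φ : A → A be the k-algebra homomorphism determined by φ(x_i) = x_i^q for all i. Then for every polynomial f ∈ A one has f ∈ I if and only if φ(f) ∈ I_q. -/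
open MvPolynomial

theorem MvPolynomial.mem_ideal_span_range_monomial {σ ι R : Type*} [CommSemiring R]
    (m : ι → (σ →₀ ℕ)) (f : MvPolynomial σ R) :
    f ∈ Ideal.span (Set.range fun j => monomial (m j) (1 : R)) ↔
      ∀ d ∈ f.support, ∃ j, m j ≤ d := by
  have h : (Set.range fun j => monomial (m j) (1 : R)) =
      (fun s => monomial s (1 : R)) '' Set.range m := by
    rw [← Set.range_comp]
    rfl
  rw [h, mem_ideal_span_monomial_image]
  simp

/-- For a squarefree monomial ideal `I` and the `k`-algebra map `φ : A → A`, `x_i ↦ x_i^q`,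
one has `f ∈ I ↔ φ(f) ∈ I_q`, where `I_q` is generated by the `q`-th powers of the minimal
monomial generators of `I`. -/
theorem mem_iff_powerMap_mem (k : Type) [Field k] (n t q : ℕ) (hq : 0 < q)
    (m : Fin t → (Fin n →₀ ℕ))
    (hsf : ∀ j i, m j i ≤ 1)
    (hmin : ∀ j j' : Fin t, m j ≤ m j' → j = j')
    (I Iq : Ideal (MvPolynomial (Fin n) k))
    (hI : I = Ideal.span (Set.range fun j => monomial (m j) (1 : k)))
    (hIq : Iq = Ideal.span (Set.range fun j => (monomial (m j) (1 : k)) ^ q)) :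
    ∀ f : MvPolynomial (Fin n) k,
      f ∈ I ↔ aeval (fun i => (X i : MvPolynomial (Fin n) k) ^ q) f ∈ Iq := by
  intro f
  have hexp : aeval (fun i => (X i : MvPolynomial (Fin n) k) ^ q) f = expand q f := rfl
  rw [hI, hIq, hexp]
  simp only [monomial_pow, one_pow]
  rw [mem_ideal_span_range_monomial, mem_ideal_span_range_monomial, support_expand f hq.ne']
  simp only [Finset.forall_mem_image]
  refine forall₂_congr fun d _ => exists_congr fun j => ?_
  simp [Finsupp.le_def, hq]
end

section
/- Let m_1,…,m_t (t ≥ 1) be distinct monomials in A = k[x_1,…,x_n], each of degree exactly 2, satisfying the minimal Taylor resolution condition, and assume that gcd(m_i, m_j) is a non-unit for every pair i, j. Then there exists a variable x_j that divides every m_i. -/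
open MvPolynomial

/-- Monomials (given by their exponent vectors) satisfy the minimal Taylor resolution
condition if for every subset `S` of indices and every `j ∈ S`, the lcm of the monomials
indexed by `S` differs from the lcm of the monomials indexed by `S \ {j}`. -/
def MinimalTaylor {n t : ℕ} (m : Fin t → (Fin n →₀ ℕ)) : Prop :=
  ∀ S : Finset (Fin t), ∀ j ∈ S, S.sup m ≠ (S.erase j).sup m

/-- Two monomials with a non-unit common divisor share a variable. -/
theorem exists_mem_support_of_not_isUnit_dvd {σ k : Type*} [Field k] {u v : σ →₀ ℕ}
    {d : MvPolynomial σ k} (hd : ¬IsUnit d) (hu : d ∣ monomial u (1 : k))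
    (hv : d ∣ monomial v (1 : k)) : ∃ a, u a ≠ 0 ∧ v a ≠ 0 := by
  have hd0 : d ≠ 0 := by
    rintro rfl
    simp at hu
  obtain ⟨p, hp, hpd⟩ := WfDvdMonoid.exists_irreducible_factor hd hd0
  have hpu := hpd.trans hu
  rw [monomial_eq, C_1, one_mul, Finsupp.prod, hp.prime.dvd_finsetProd_iff] at hpu
  obtain ⟨a, -, ha⟩ := hpu
  have hassoc : Associated p (X a) :=
    hp.associated_of_dvd (X_prime (i := a)).irreducible (hp.prime.dvd_of_dvd_pow ha)
  have h1 := (hassoc.symm.dvd.trans hpd).trans hu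
  have h2 := (hassoc.symm.dvd.trans hpd).trans hv
  rw [X_dvd_monomial] at h1 h2
  exact ⟨a, h1.resolve_left one_ne_zero, h2.resolve_left one_ne_zero⟩

/-- Under the minimal Taylor resolution condition every monomial is divisible by a variable whose
exponent is strictly smaller in all the other monomials. -/
theorem MinimalTaylor.exists_forall_lt {n t : ℕ} {m : Fin t → (Fin n →₀ ℕ)}
    (h : MinimalTaylor m) (j : Fin t) : ∃ p, m j p ≠ 0 ∧ ∀ l ≠ j, m l p < m j p := by
  by_contra! hc
  refine h Finset.univ j (Finset.mem_univ j)
    (le_antisymm (Finset.sup_le fun l _ => ?_) (Finset.sup_mono (Finset.erase_subset _ _)))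
  by_cases hl : l = j
  · subst hl
    intro p
    by_cases h0 : m l p = 0
    · simp [h0]
    obtain ⟨i, hi, hip⟩ := hc p h0
    have hle : m i ≤ (Finset.univ.erase l).sup m := Finset.le_sup (by simp [hi])
    exact hip.trans (hle p)
  · exact Finset.le_sup (by simp [hl])

/-- If `m_1,…,m_t` are distinct quadratic monomials with minimal Taylor resolution such
that every pair has a non-unit common divisor, then some variable divides every `m_i`. -/
theorem exists_common_variable_of_quadratic (k : Type) [Field k] (n t : ℕ) (ht : 1 ≤ t)
    (m : Fin t → (Fin n →₀ ℕ))
    (hdist : Function.Injective m)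
    (hdeg : ∀ j, (m j).sum (fun _ e => e) = 2)
    (hmt : MinimalTaylor m)
    (hcommon : ∀ i j : Fin t, ∃ d : MvPolynomial (Fin n) k, ¬IsUnit d ∧
        d ∣ monomial (m i) (1 : k) ∧ d ∣ monomial (m j) (1 : k)) :
    ∃ i : Fin n, ∀ j : Fin t, (X i : MvPolynomial (Fin n) k) ∣ monomial (m j) (1 : k) := by
  suffices h : ∃ i : Fin n, ∀ j : Fin t, m j i ≠ 0 by
    obtain ⟨i, hi⟩ := h
    exact ⟨i, fun j => X_dvd_monomial.2 (Or.inr (hi j))⟩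
  have hshare : ∀ i j, ∃ a, m i a ≠ 0 ∧ m j a ≠ 0 := fun i j => by
    obtain ⟨d, hd, hi, hj⟩ := hcommon i j
    exact exists_mem_support_of_not_isUnit_dvd hd hi hj
  let j : Fin t := ⟨0, ht⟩
  obtain ⟨p, hjp, hp⟩ := hmt.exists_forall_lt j
  have hsum : ∑ i, m j i = 2 := by
    rw [← hdeg j, Finsupp.sum_fintype _ _ fun _ => rfl]
  by_cases hall : ∀ l, m l p ≠ 0
  · exact ⟨p, hall⟩
  push Not at hall
  obtain ⟨l, hl⟩ := hall
  obtain ⟨q, hq, hlq⟩ := hshare j l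
  have hqp : q ≠ p := by
    rintro rfl
    exact hlq hl
  have hpair : m j p + m j q ≤ 2 := by
    rw [← hsum, ← Finset.sum_pair hqp.symm]
    exact Finset.sum_le_sum_of_subset (Finset.subset_univ _)
  refine ⟨q, fun i => ?_⟩
  by_cases hij : i = j
  · exact hij ▸ hq
  obtain ⟨a, ha, hia⟩ := hshare j i
  have hap : a ≠ p := by
    rintro rfl
    have := hp i hij
    omega
  by_cases haq : a = q
  · exact haq ▸ hia
  have htriple : m j p + (m j q + m j a) ≤ 2 := by
    rw [← hsum, ← Finset.sum_pair (Ne.symm haq),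
      ← Finset.sum_insert (by simp [hqp.symm, hap.symm])]
    exact Finset.sum_le_sum_of_subset (Finset.subset_univ _)
  omega
end
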